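/- arXiv:2404.19517 — 7 statements merged into one kernel-verified Lean document; each statement's English description precedes it below -/
import Mathlib

section
/- Let f : ℝ^p → ℝ be continuously differentiable, let ε ≥ 0, T ∈ (0,∞], and let x be an ε-biased gradient curve of f on [0,T). Then for all 0 ≤ t₁ ≤ t₂ < T one has f(x(t₂)) − f(x(t₁)) ≤ −∫_{t₁}^{t₂} ‖∇f(x(t))‖·(‖∇f(x(t))‖ − ε) dt. Moreover, if f(x(0)) ∉ vcrit_ε f, then there exists t ∈ (0,T) such that f(x(s)) < f(x(0)) for all s ∈ (0,t]. -/
open Filter MeasureTheory Metric Set Topology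
open scoped ENNReal NNReal

abbrev Ep (p : ℕ) := EuclideanSpace ℝ (Fin p)

def critSet {p : ℕ} (f : Ep p → ℝ) (ε : ℝ) : Set (Ep p) := {x | ‖gradient f x‖ ≤ ε}

def vcritSet {p : ℕ} (f : Ep p → ℝ) (ε : ℝ) : Set ℝ := f '' critSet f ε

/-- An `ε`-biased gradient curve of `f` on the interval `I ⊆ [0,∞)`: a locally Lipschitz
curve on `I` which is differentiable a.e. on `I` with `‖x'(t) + ∇f(x(t))‖ ≤ ε`. -/
def IsBiasedGradCurve {p : ℕ} (f : Ep p → ℝ) (ε : ℝ) (I : Set ℝ) (x : ℝ → Ep p) : Prop :=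
  (∀ t ∈ I, ∃ K : NNReal, ∃ s ∈ nhdsWithin t I, LipschitzOnWith K x s) ∧
  ∀ᵐ t ∂(volume.restrict I), DifferentiableAt ℝ x t ∧ ‖deriv x t + gradient f (x t)‖ ≤ ε

theorem ContDiff.continuous_gradient {E : Type*} [NormedAddCommGroup E] [InnerProductSpace ℝ E]
    [CompleteSpace E] {f : E → ℝ} (hf : ContDiff ℝ 1 f) : Continuous (gradient f) :=
  (InnerProductSpace.toDual ℝ E).symm.continuous.comp (hf.continuous_fderiv one_ne_zero)

theorem LocallyLipschitz.comp_locallyLipschitzOn {α β γ : Type*} [PseudoEMetricSpace α]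
    [PseudoEMetricSpace β] [PseudoEMetricSpace γ] {f : β → γ} {g : α → β} {s : Set α}
    (hf : LocallyLipschitz f) (hg : LocallyLipschitzOn s g) : LocallyLipschitzOn s (f ∘ g) :=
  locallyLipschitzOn_iff_restrict.2 (hf.comp hg.restrict)

/-- If `v` is within `ε` of `-g`, then `⟪g, v⟫ ≤ -‖g‖ (‖g‖ - ε)`. -/
theorem inner_le_neg_norm_mul_norm_sub {E : Type*} [NormedAddCommGroup E]
    [InnerProductSpace ℝ E] {g v : E} {ε : ℝ} (h : ‖v + g‖ ≤ ε) :
    inner ℝ g v ≤ -(‖g‖ * (‖g‖ - ε)) := by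
  have hcs := real_inner_le_norm g (v + g)
  rw [inner_add_right, real_inner_self_eq_norm_sq] at hcs
  nlinarith [mul_le_mul_of_nonneg_left h (norm_nonneg g)]

theorem sub_le_neg_integral_of_biasedGradCurve {E : Type*} [NormedAddCommGroup E]
    [InnerProductSpace ℝ E] [CompleteSpace E] {f : E → ℝ} (hf : ContDiff ℝ 1 f) {ε a b : ℝ}
    (hab : a ≤ b) {x : ℝ → E} (hlip : LocallyLipschitzOn (Icc a b) x)
    (hderiv : ∀ᵐ t ∂(volume.restrict (Icc a b)),
      DifferentiableAt ℝ x t ∧ ‖deriv x t + gradient f (x t)‖ ≤ ε) :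
    f (x b) - f (x a) ≤ -∫ t in a..b, ‖gradient f (x t)‖ * (‖gradient f (x t)‖ - ε) := by
  obtain ⟨K, hK⟩ :=
    (hf.locallyLipschitz.comp_locallyLipschitzOn hlip).exists_lipschitzOnWith_of_compact
      isCompact_Icc
  rw [← uIcc_of_le hab] at hK
  have hac := hK.absolutelyContinuousOnInterval
  have hcont : ContinuousOn (fun t => ‖gradient f (x t)‖) (uIcc a b) := by
    rw [uIcc_of_le hab]
    exact (hf.continuous_gradient.comp_continuousOn hlip.continuousOn).norm
  have hint : IntervalIntegrable
      (fun t => -(‖gradient f (x t)‖ * (‖gradient f (x t)‖ - ε))) volume a b :=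
    (hcont.mul (hcont.sub continuousOn_const)).neg.intervalIntegrable
  rw [← intervalIntegral.integral_neg]
  refine hac.integral_deriv_eq_sub.symm.le.trans
    (intervalIntegral.integral_mono_ae_restrict hab hac.intervalIntegrable_deriv hint ?_)
  filter_upwards [hderiv] with t ht
  have hd := (hf.differentiable one_ne_zero (x t)).hasFDerivAt.comp_hasDerivAt t ht.1.hasDerivAt
  rw [hd.deriv, ← toDual_gradient, InnerProductSpace.toDual_apply_apply]
  exact inner_le_neg_norm_mul_norm_sub ht.2

theorem stmt0 {p : ℕ} (f : Ep p → ℝ) (hf : ContDiff ℝ 1 f)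
    (ε : ℝ) (hε : 0 ≤ ε) (T : ℝ≥0∞) (hT : 0 < T)
    (x : ℝ → Ep p)
    (hx : IsBiasedGradCurve f ε {t : ℝ | 0 ≤ t ∧ ENNReal.ofReal t < T} x) :
    (∀ t₁ t₂ : ℝ, 0 ≤ t₁ → t₁ ≤ t₂ → ENNReal.ofReal t₂ < T →
      f (x t₂) - f (x t₁) ≤
        -∫ t in t₁..t₂, ‖gradient f (x t)‖ * (‖gradient f (x t)‖ - ε)) ∧
    (f (x 0) ∉ vcritSet f ε →
      ∃ t : ℝ, 0 < t ∧ ENNReal.ofReal t < T ∧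
        ∀ s : ℝ, 0 < s → s ≤ t → f (x s) < f (x 0)) := by
  set I : Set ℝ := {t : ℝ | 0 ≤ t ∧ ENNReal.ofReal t < T}
  have hlip : LocallyLipschitzOn I x := fun t ht => hx.1 t ht
  have hIcc {a b : ℝ} (ha : 0 ≤ a) (hb : ENNReal.ofReal b < T) : Icc a b ⊆ I := fun t ht =>
    ⟨ha.trans ht.1, (ENNReal.ofReal_le_ofReal ht.2).trans_lt hb⟩
  have hdescent (t₁ t₂ : ℝ) (h₁ : 0 ≤ t₁) (h₁₂ : t₁ ≤ t₂) (h₂ : ENNReal.ofReal t₂ < T) :=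
    sub_le_neg_integral_of_biasedGradCurve hf h₁₂ (hlip.mono (hIcc h₁ h₂))
      (ae_restrict_of_ae_restrict_of_subset (hIcc h₁ h₂) hx.2)
  refine ⟨hdescent, fun hcrit => ?_⟩
  have h0 : ε < ‖gradient f (x 0)‖ := not_le.1 fun h => hcrit ⟨x 0, h, rfl⟩
  have hcont : ContinuousOn (fun t => ‖gradient f (x t)‖) I :=
    (hf.continuous_gradient.comp_continuousOn hlip.continuousOn).norm
  obtain ⟨δ, hδ, hδT⟩ : ∃ δ > 0, ENNReal.ofReal δ < T := by
    obtain ⟨r, hr, hrT⟩ := ENNReal.lt_iff_exists_nnreal_btwn.1 hT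
    exact ⟨r, by exact_mod_cast hr, by simpa using hrT⟩
  obtain ⟨η, hη, hball⟩ := Metric.mem_nhdsWithin_iff.1
    ((hcont 0 ⟨le_rfl, by simpa using hT⟩).eventually (lt_mem_nhds h0))
  obtain ⟨t, ht, htmin⟩ := exists_between (lt_min hδ hη)
  have htT : ENNReal.ofReal t < T :=
    (ENNReal.ofReal_le_ofReal (htmin.le.trans (min_le_left _ _))).trans_lt hδT
  refine ⟨t, ht, htT, fun s hs hst => ?_⟩
  have hsT := (ENNReal.ofReal_le_ofReal hst).trans_lt htT
  have hpos : 0 < ∫ u in (0 : ℝ)..s, ‖gradient f (x u)‖ * (‖gradient f (x u)‖ - ε) := by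
    have hcont' := hcont.mono (hIcc le_rfl hsT)
    rw [← uIcc_of_le hs.le] at hcont'
    refine intervalIntegral.intervalIntegral_pos_of_pos_on
      (hcont'.mul (hcont'.sub continuousOn_const)).intervalIntegrable (fun u hu => ?_) hs
    have hgrad : ε < ‖gradient f (x u)‖ := by
      refine hball ⟨?_, hIcc le_rfl hsT (Ioo_subset_Icc_self hu)⟩
      rw [Metric.mem_ball, Real.dist_0_eq_abs, abs_of_pos hu.1]
      exact hu.2.trans_le (hst.trans (htmin.le.trans (min_le_right _ _)))
    exact mul_pos (hε.trans_lt hgrad) (sub_pos.2 hgrad)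
  linarith [hdescent 0 s le_rfl hs.le hsT]
end

section
/- Let f : ℝ^p → ℝ be continuously differentiable, let ε ≥ 0, and let x be an ε-biased gradient curve of f on [0,∞). If l ∈ ℝ does not belong to the closure of vcrit_ε f and f(x(0)) ≤ l, then f(x(t)) < l for all t > 0. -/
open Filter MeasureTheory Metric Set Topology
open scoped ENNReal NNReal

theorem ContDiff.continuous_gradient_s1 {p : ℕ} {f : Ep p → ℝ} (hf : ContDiff ℝ 1 f) :
    Continuous (gradient f) :=
  (InnerProductSpace.toDual ℝ (Ep p)).symm.continuous.comp (hf.continuous_fderiv one_ne_zero)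

theorem inner_gradient_le {p : ℕ} {g v : Ep p} {ε : ℝ} (h : ‖v + g‖ ≤ ε) :
    inner ℝ g v ≤ -(‖g‖ * (‖g‖ - ε)) := by
  have h1 : inner ℝ g v = inner ℝ g (v + g) - ‖g‖ ^ 2 := by
    rw [inner_add_right, real_inner_self_eq_norm_sq]; ring
  have h2 := real_inner_le_norm g (v + g)
  have h3 := mul_le_mul_of_nonneg_left h (norm_nonneg g)
  nlinarith

namespace IsBiasedGradCurve

variable {p : ℕ} {f : Ep p → ℝ} {ε : ℝ} {x : ℝ → Ep p}

theorem mono {I J : Set ℝ} (hx : IsBiasedGradCurve f ε J x) (hIJ : I ⊆ J) :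
    IsBiasedGradCurve f ε I x :=
  ⟨LocallyLipschitzOn.mono (fun t ht ↦ hx.1 t ht) hIJ,
    ae_restrict_of_ae_restrict_of_subset hIJ hx.2⟩

theorem continuousOn {I : Set ℝ} (hx : IsBiasedGradCurve f ε I x) : ContinuousOn x I :=
  LocallyLipschitzOn.continuousOn fun t ht ↦ hx.1 t ht

theorem comp_lt_of_forall_lt_norm_gradient {a b : ℝ} (hf : ContDiff ℝ 1 f) (hε : 0 ≤ ε)
    (hab : a < b) (hx : IsBiasedGradCurve f ε (Icc a b) x)
    (hgrad : ∀ t ∈ Icc a b, ε < ‖gradient f (x t)‖) : f (x b) < f (x a) := by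
  obtain ⟨K, hK⟩ := LocallyLipschitzOn.exists_lipschitzOnWith_of_compact isCompact_Icc
    (fun t ht ↦ hx.1 t ht : LocallyLipschitzOn (Icc a b) x)
  obtain ⟨L, hL⟩ := LocallyLipschitzOn.exists_lipschitzOnWith_of_compact
    (isCompact_Icc.image_of_continuousOn hx.continuousOn)
    (hf.locallyLipschitz.locallyLipschitzOn (s := x '' Icc a b))
  have hac : AbsolutelyContinuousOnInterval (f ∘ x) a b :=
    LipschitzOnWith.absolutelyContinuousOnInterval (K := L * K)
      (by rw [uIcc_of_le hab.le]; exact hL.comp hK (mapsTo_image _ _))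
  have hgradc : ContinuousOn (fun t ↦ ‖gradient f (x t)‖) (Icc a b) :=
    (hf.continuous_gradient_s1.comp_continuousOn hx.continuousOn).norm
  have hint : IntervalIntegrable
      (fun t ↦ ‖gradient f (x t)‖ * (‖gradient f (x t)‖ - ε)) volume a b :=
    ContinuousOn.intervalIntegrable_of_Icc hab.le (hgradc.mul (hgradc.sub continuousOn_const))
  have hpos : 0 < ∫ t in a..b, ‖gradient f (x t)‖ * (‖gradient f (x t)‖ - ε) := by
    refine intervalIntegral.intervalIntegral_pos_of_pos_on hint (fun t ht ↦ ?_) hab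
    have := hgrad t (Ioo_subset_Icc_self ht)
    exact mul_pos (hε.trans_lt this) (sub_pos.2 this)
  have hle : ∫ t in a..b, deriv (f ∘ x) t ≤
      ∫ t in a..b, -(‖gradient f (x t)‖ * (‖gradient f (x t)‖ - ε)) := by
    refine intervalIntegral.integral_mono_ae_restrict hab.le hac.intervalIntegrable_deriv
      hint.neg ?_
    filter_upwards [hx.2] with t ht
    have hd : DifferentiableAt ℝ f (x t) := hf.differentiable one_ne_zero _
    rw [fderiv_comp_deriv t hd ht.1, ← inner_gradient_left]
    exact inner_gradient_le ht.2
  rw [hac.integral_deriv_eq_sub, intervalIntegral.integral_neg] at hle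
  simp only [Function.comp_apply] at hle
  linarith

/-- Near a time at which `f ∘ x` takes a value outside the closure of the set of `ε`-critical
values, `f ∘ x` is strictly decreasing. -/
theorem exists_strictAntiOn (hf : ContDiff ℝ 1 f) (hε : 0 ≤ ε)
    (hx : IsBiasedGradCurve f ε (Ici 0) x) {s : ℝ} (hs : 0 ≤ s)
    (hl : f (x s) ∉ closure (vcritSet f ε)) :
    ∃ δ > 0, StrictAntiOn (f ∘ x) (Ioo (s - δ) (s + δ) ∩ Ici 0) := by
  have hmem : {t | f (x t) ∈ (closure (vcritSet f ε))ᶜ} ∈ 𝓝[Ici 0] s :=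
    (hf.continuous.comp_continuousOn hx.continuousOn) s hs
      (isClosed_closure.isOpen_compl.mem_nhds hl)
  obtain ⟨δ, hδ, hsub⟩ := Metric.mem_nhdsWithin_iff.1 hmem
  rw [Real.ball_eq_Ioo] at hsub
  refine ⟨δ, hδ, fun a ha b hb hab ↦ ?_⟩
  refine comp_lt_of_forall_lt_norm_gradient hf hε hab
    (hx.mono fun t ht ↦ ha.2.trans ht.1) fun t ht ↦ ?_
  by_contra! hcrit
  exact hsub ⟨⟨ha.1.1.trans_le ht.1, ht.2.trans_lt hb.1.2⟩, ha.2.trans ht.1⟩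
    (subset_closure (mem_image_of_mem f hcrit))

theorem comp_le (hf : ContDiff ℝ 1 f) (hε : 0 ≤ ε) (hx : IsBiasedGradCurve f ε (Ici 0) x)
    {l : ℝ} (hl : l ∉ closure (vcritSet f ε)) (h0 : f (x 0) ≤ l) {t : ℝ} (ht : 0 ≤ t) :
    f (x t) ≤ l := by
  have hcont : ContinuousOn (f ∘ x) (Icc 0 t) :=
    hf.continuous.comp_continuousOn (hx.continuousOn.mono Icc_subset_Ici_self)
  have hclosed : IsClosed ({s | f (x s) ≤ l} ∩ Icc 0 t) := by
    rw [inter_comm]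
    exact hcont.preimage_isClosed_of_isClosed isClosed_Icc isClosed_Iic
  refine hclosed.Icc_subset_of_forall_exists_gt h0 (fun s hs y hy ↦ ?_) (right_mem_Icc.2 ht)
  rcases lt_or_eq_of_le (show f (x s) ≤ l from hs.1) with hlt | heq
  · have hev : ∀ᶠ u in 𝓝[Icc 0 t] s, f (x u) < l :=
      hcont s (Ico_subset_Icc_self hs.2) (Iio_mem_nhds hlt)
    have hsub : 𝓝[>] s ≤ 𝓝[Icc 0 t] s :=
      nhdsWithin_le_of_mem (mem_of_superset (Ioc_mem_nhdsGT hs.2.2)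
        fun u hu ↦ ⟨hs.2.1.trans hu.1.le, hu.2⟩)
    obtain ⟨u, hu, huy⟩ := Filter.nonempty_of_mem (inter_mem (hsub hev) (Ioc_mem_nhdsGT hy))
    exact ⟨u, (show f (x u) < l from hu).le, huy⟩
  · obtain ⟨δ, hδ, hanti⟩ := hx.exists_strictAntiOn hf hε hs.2.1 (heq ▸ hl)
    obtain ⟨u, hu, huy⟩ :=
      Filter.nonempty_of_mem (inter_mem (Ioo_mem_nhdsGT (lt_add_of_pos_right s hδ))
        (Ioc_mem_nhdsGT hy))
    have := hanti ⟨⟨by linarith, by linarith⟩, hs.2.1⟩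
      ⟨⟨by linarith [hu.1], hu.2⟩, hs.2.1.trans hu.1.le⟩ hu.1
    exact ⟨u, (this.trans_eq heq).le, huy⟩

end IsBiasedGradCurve

theorem stmt1 {p : ℕ} (f : Ep p → ℝ) (hf : ContDiff ℝ 1 f)
    (ε : ℝ) (hε : 0 ≤ ε) (x : ℝ → Ep p)
    (hx : IsBiasedGradCurve f ε (Set.Ici 0) x)
    (l : ℝ) (hl : l ∉ closure (vcritSet f ε)) (h0 : f (x 0) ≤ l) :
    ∀ t : ℝ, 0 < t → f (x t) < l := by
  intro t ht
  refine (hx.comp_le hf hε hl h0 ht.le).lt_of_ne fun heq ↦ ?_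
  obtain ⟨δ, hδ, hanti⟩ := hx.exists_strictAntiOn hf hε ht.le (heq ▸ hl)
  obtain ⟨u, hu, hut⟩ := exists_between (max_lt ht (sub_lt_self t hδ))
  obtain ⟨hu0, huδ⟩ := max_lt_iff.1 hu
  have := hanti ⟨⟨huδ, by linarith⟩, hu0.le⟩ ⟨⟨by linarith, by linarith⟩, ht.le⟩ hut
  exact (this.trans_le (hx.comp_le hf hε hl h0 hu0.le)).ne heq
end

section
/- Let f : ℝ^p → ℝ be continuously differentiable, let ε ≥ 0, let 0 ≤ a < b and δ > ε, and set T = (b − a)/(δ(δ − ε)). Let x be an ε-biased gradient curve of f on [0,T] such that f(x(t)) ∈ [a,b] for all t ∈ [0,T]. Then there exists t ∈ [0,T] such that ‖∇f(x(t))‖ ≤ δ. -/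
open Filter MeasureTheory Metric Set Topology
open scoped ENNReal NNReal

/-- If `y` is within `ε` of `-v`, then `⟪v, y⟫ ≤ -‖v‖ (‖v‖ - ε)`. -/
lemma inner_le_of_norm_add_le {E : Type*} [NormedAddCommGroup E] [InnerProductSpace ℝ E]
    {v y : E} {ε : ℝ} (h : ‖y + v‖ ≤ ε) : inner ℝ v y ≤ -(‖v‖ * (‖v‖ - ε)) := by
  have h1 : inner ℝ v (y + v) ≤ ‖v‖ * ε :=
    (real_inner_le_norm _ _).trans (mul_le_mul_of_nonneg_left h (norm_nonneg _))
  rw [inner_add_right, real_inner_self_eq_norm_sq] at h1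
  linarith

lemma ContDiff.exists_lipschitzOnWith_comp_of_compact {E : Type*} [NormedAddCommGroup E]
    [NormedSpace ℝ E] {f : E → ℝ} (hf : ContDiff ℝ 1 f) {x : ℝ → E} {s : Set ℝ}
    (hs : IsCompact s) (hx : LocallyLipschitzOn s x) : ∃ K, LipschitzOnWith K (f ∘ x) s := by
  obtain ⟨K, hK⟩ := hx.exists_lipschitzOnWith_of_compact hs
  obtain ⟨L, hL⟩ := (hf.locallyLipschitz.locallyLipschitzOn
    (s := x '' s)).exists_lipschitzOnWith_of_compact (hs.image_of_continuousOn hx.continuousOn)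
  exact ⟨L * K, hL.comp hK (mapsTo_image x s)⟩

/-- Along an `ε`-biased gradient curve staying where `‖∇f‖ ≥ m ≥ ε`, the function `f`
decreases at rate at least `m (m - ε)`. -/
lemma IsBiasedGradCurve.sub_le_of_le_norm_gradient {p : ℕ} {f : Ep p → ℝ} (hf : ContDiff ℝ 1 f)
    {ε m T : ℝ} (hm : ε ≤ m) (hT : 0 ≤ T) {x : ℝ → Ep p}
    (hx : IsBiasedGradCurve f ε (Icc 0 T) x)
    (hgrad : ∀ t ∈ Icc 0 T, m ≤ ‖gradient f (x t)‖) :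
    f (x T) - f (x 0) ≤ -(m * (m - ε)) * T := by
  obtain ⟨K, hK⟩ := hf.exists_lipschitzOnWith_comp_of_compact isCompact_Icc hx.1
  have hac : AbsolutelyContinuousOnInterval (f ∘ x) 0 T := by
    rw [← uIcc_of_le hT] at hK
    exact hK.absolutelyContinuousOnInterval
  have hderiv : deriv (f ∘ x) ≤ᵐ[volume.restrict (Icc 0 T)] fun _ => -(m * (m - ε)) := by
    filter_upwards [hx.2, ae_restrict_mem measurableSet_Icc] with t ⟨hd, hb⟩ ht
    have hfd : DifferentiableAt ℝ f (x t) := hf.differentiable one_ne_zero (x t)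
    rw [fderiv_comp_deriv t hfd hd, ← inner_gradient_left]
    have hle := inner_le_of_norm_add_le hb
    have hg := hgrad t ht
    linarith [mul_le_mul hg (sub_le_sub_right hg ε) (sub_nonneg.2 hm) (norm_nonneg _)]
  have hint := intervalIntegral.integral_mono_ae_restrict hT hac.intervalIntegrable_deriv
    intervalIntegrable_const hderiv
  rw [hac.integral_deriv_eq_sub, intervalIntegral.integral_const, smul_eq_mul] at hint
  simp only [Function.comp_apply] at hint
  linarith

theorem stmt3 {p : ℕ} (f : Ep p → ℝ) (hf : ContDiff ℝ 1 f)
    (ε : ℝ) (hε : 0 ≤ ε) (a b δ : ℝ) (ha : 0 ≤ a) (hab : a < b) (hδ : ε < δ)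
    (T : ℝ) (hTdef : T = (b - a) / (δ * (δ - ε)))
    (x : ℝ → Ep p) (hx : IsBiasedGradCurve f ε (Set.Icc 0 T) x)
    (hrange : ∀ t ∈ Set.Icc (0:ℝ) T, f (x t) ∈ Set.Icc a b) :
    ∃ t ∈ Set.Icc (0:ℝ) T, ‖gradient f (x t)‖ ≤ δ := by
  by_contra! hcon
  have hδ0 : 0 < δ := hε.trans_lt hδ
  have hc : 0 < δ * (δ - ε) := mul_pos hδ0 (sub_pos.2 hδ)
  have hT : 0 < T := hTdef ▸ div_pos (sub_pos.2 hab) hc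
  have hTc : δ * (δ - ε) * T = b - a := by rw [hTdef]; exact mul_div_cancel₀ _ hc.ne'
  have hgc : Continuous (gradient f) :=
    (InnerProductSpace.toDual ℝ (Ep p)).symm.continuous.comp (hf.continuous_fderiv one_ne_zero)
  have hxc : ContinuousOn x (Icc 0 T) := LocallyLipschitzOn.continuousOn hx.1
  obtain ⟨t₀, ht₀, hmin⟩ := isCompact_Icc.exists_isMinOn (nonempty_Icc.2 hT.le)
    (hgc.norm.comp_continuousOn hxc)
  have hm := hcon t₀ ht₀
  have hle := hx.sub_le_of_le_norm_gradient hf (hδ.trans hm).le hT.le fun t ht => hmin ht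
  have h0 := (hrange 0 (left_mem_Icc.2 hT.le)).2
  have h1 := (hrange T (right_mem_Icc.2 hT.le)).1
  have hlt : δ * (δ - ε) * T < ‖gradient f (x t₀)‖ * (‖gradient f (x t₀)‖ - ε) * T :=
    mul_lt_mul_of_pos_right (mul_lt_mul'' hm (sub_lt_sub_right hm ε) hδ0.le (sub_pos.2 hδ).le) hT
  linarith
end

section
/- Let f : ℝ^p → ℝ be continuously differentiable and bounded below. Then for every x ∈ ℝ^p and every a ∈ (0,1), there exists y ∈ ℝ^p such that ‖y‖ ≥ ‖x‖ − ‖x‖^a and ‖∇f(y)‖ · ‖x‖^a ≤ f(x) − inf f. -/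
open Filter MeasureTheory Metric Set Topology
open scoped ENNReal NNReal

/-- If `f` decreases at most at rate `c` away from `y`, then its derivative at `y` has norm at
most `c`. -/
theorem norm_fderiv_le_of_forall_le_add {E : Type*} [NormedAddCommGroup E] [NormedSpace ℝ E]
    {f : E → ℝ} {L : E →L[ℝ] ℝ} {y : E} {c : ℝ} (hL : HasFDerivAt f L y) (hc : 0 ≤ c)
    (h : ∀ z, f y ≤ f z + c * ‖z - y‖) : ‖L‖ ≤ c := by
  have lower : ∀ v : E, -(c * ‖v‖) ≤ L v := by
    intro v
    have hslope : Tendsto (slope (fun t : ℝ => f (y + t • v)) 0) (𝓝[>] 0) (𝓝 (L v)) :=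
      (hasDerivWithinAt_iff_tendsto_slope' (by simp)).1 (hL.hasLineDerivAt v).hasDerivWithinAt
    refine ge_of_tendsto hslope ?_
    filter_upwards [self_mem_nhdsWithin] with t ht
    have ht : 0 < t := ht
    have hz := h (y + t • v)
    rw [add_sub_cancel_left, norm_smul, Real.norm_of_nonneg ht.le] at hz
    rw [slope_def_field, zero_smul, add_zero, sub_zero, le_div_iff₀ ht]
    linarith
  refine L.opNorm_le_bound hc fun v => ?_
  rw [Real.norm_eq_abs, abs_le]
  refine ⟨lower v, ?_⟩
  have := lower (-v)
  rw [norm_neg, map_neg] at this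
  linarith

/-- Ekeland's variational principle in a proper space, with the error taken to be
`f x - inf f`. -/
theorem exists_dist_le_forall_le_add {E : Type*} [PseudoMetricSpace E] [ProperSpace E]
    {f : E → ℝ} (hf : Continuous f) (hbd : BddBelow (Set.range f)) (x : E) {r : ℝ}
    (hr : 0 < r) :
    ∃ y, dist y x ≤ r ∧ ∀ z, f y ≤ f z + (f x - sInf (Set.range f)) / r * dist z y := by
  have hinf : ∀ z, sInf (Set.range f) ≤ f z := fun z => csInf_le hbd (Set.mem_range_self z)
  set c := (f x - sInf (Set.range f)) / r
  have hc0 : 0 ≤ c := div_nonneg (sub_nonneg.2 (hinf x)) hr.le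
  have hcr : c * r = f x - sInf (Set.range f) := div_mul_cancel₀ _ hr.ne'
  have hx : x ∈ closedBall x r := mem_closedBall_self hr.le
  obtain ⟨y, hy, hmin⟩ := (isCompact_closedBall x r).exists_isMinOn ⟨x, hx⟩
    (f := fun z => f z + c * dist z x) (by fun_prop)
  refine ⟨y, hy, fun z => ?_⟩
  have hyz : f y + c * dist y x ≤ f z + c * dist z x := by
    by_cases hz : z ∈ closedBall x r
    · exact hmin hz
    · have hyx : f y + c * dist y x ≤ f x + c * dist x x := hmin hx
      have hrz : c * r ≤ c * dist z x := by
        rw [mem_closedBall, not_le] at hz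
        gcongr
      rw [dist_self, mul_zero] at hyx
      linarith [hinf z]
  have htri : c * dist z x ≤ c * (dist z y + dist y x) := by
    gcongr
    exact dist_triangle z y x
  linarith

theorem stmt8 {p : ℕ} (f : Ep p → ℝ) (hf : ContDiff ℝ 1 f)
    (hbd : BddBelow (Set.range f)) :
    ∀ x : Ep p, ∀ a : ℝ, 0 < a → a < 1 →
      ∃ y : Ep p, ‖x‖ - ‖x‖ ^ a ≤ ‖y‖ ∧
        ‖gradient f y‖ * ‖x‖ ^ a ≤ f x - sInf (Set.range f) := by
  intro x a ha _
  have hx : 0 ≤ f x - sInf (Set.range f) :=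
    sub_nonneg.2 (csInf_le hbd (Set.mem_range_self x))
  rcases eq_or_ne x 0 with rfl | hx0
  · exact ⟨0, by simp [Real.zero_rpow ha.ne'], by simpa [Real.zero_rpow ha.ne'] using hx⟩
  have hr : 0 < ‖x‖ ^ a := Real.rpow_pos_of_pos (norm_pos_iff.2 hx0) a
  obtain ⟨y, hyx, hy⟩ := exists_dist_le_forall_le_add hf.continuous hbd x hr
  refine ⟨y, ?_, ?_⟩
  · rw [dist_comm, dist_eq_norm] at hyx
    linarith [norm_sub_norm_le x y]
  · rw [← le_div_iff₀ hr, gradient, LinearIsometryEquiv.norm_map]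
    simp only [dist_eq_norm] at hy
    exact norm_fderiv_le_of_forall_le_add
      (hf.differentiable one_ne_zero y).hasFDerivAt (div_nonneg hx hr.le) hy
end

section
/- Let f : ℝ^p → ℝ be continuously differentiable and bounded below. If there exists ε̄ > 0 such that the set crit_{ε̄} f = {x ∈ ℝ^p : ‖∇f(x)‖ ≤ ε̄} is bounded, then f is coercive, i.e., f(x) → +∞ as ‖x‖ → ∞ (for every M ∈ ℝ there exists R > 0 such that ‖x‖ ≥ R implies f(x) ≥ M). -/
open Filter MeasureTheory Metric Set Topology
open scoped ENNReal NNReal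

/-- If `f` decreases at rate at most `ε` away from `y`, its derivative at `y` has norm at
most `ε`. -/
lemma norm_fderiv_le_of_forall_sub_le {E : Type*} [NormedAddCommGroup E] [NormedSpace ℝ E]
    {f : E → ℝ} {y : E} {ε : ℝ} (hε : 0 ≤ ε) (hf : DifferentiableAt ℝ f y)
    (h : ∀ z, f y - ε * ‖z - y‖ ≤ f z) : ‖fderiv ℝ f y‖ ≤ ε := by
  have key : ∀ v, -(ε * ‖v‖) ≤ fderiv ℝ f y v := by
    intro v
    have hd : HasDerivAt (fun t : ℝ => f (y + t • v)) (fderiv ℝ f y v) 0 :=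
      hf.hasFDerivAt.hasLineDerivAt v
    refine ge_of_tendsto hd.tendsto_slope_zero_right ?_
    filter_upwards [self_mem_nhdsWithin] with t (ht : 0 < t)
    have := h (y + t • v)
    rw [add_sub_cancel_left, norm_smul, Real.norm_of_nonneg ht.le] at this
    simp only [zero_add, zero_smul, add_zero, smul_eq_mul]
    rw [inv_mul_eq_div, le_div_iff₀ ht]
    linarith
  refine ContinuousLinearMap.opNorm_le_bound _ hε fun v => abs_le.mpr ⟨key v, ?_⟩
  have := key (-v)
  rw [map_neg, norm_neg] at this
  linarith

/-- A form of Ekeland's variational principle in proper spaces. -/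
lemma exists_forall_sub_mul_norm_le {E : Type*} [NormedAddCommGroup E] [ProperSpace E]
    {f : E → ℝ} (hf : Continuous f) (hbd : BddBelow (Set.range f)) {ε : ℝ} (hε : 0 < ε) (x : E) :
    ∃ y, f y + ε * ‖y - x‖ ≤ f x ∧ ∀ z, f y - ε * ‖z - y‖ ≤ f z := by
  obtain ⟨m, hm⟩ := hbd
  have hlim : Tendsto (fun y => f y + ε * ‖y - x‖) (cocompact E) atTop := by
    refine tendsto_atTop_add_left_of_le _ m (fun y => hm ⟨y, rfl⟩) ?_
    refine Tendsto.const_mul_atTop hε ?_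
    simpa only [dist_eq_norm] using tendsto_dist_right_cocompact_atTop x
  have : Nonempty E := ⟨x⟩
  obtain ⟨y, hy⟩ := Continuous.exists_forall_le (by fun_prop) hlim
  refine ⟨y, by simpa using hy x, fun z => ?_⟩
  have h₁ := hy z
  have h₂ := mul_le_mul_of_nonneg_left (norm_sub_le_norm_sub_add_norm_sub z y x) hε.le
  linarith

theorem stmt9 {p : ℕ} (f : Ep p → ℝ) (hf : ContDiff ℝ 1 f)
    (hbd : BddBelow (Set.range f))
    (εb : ℝ) (hεb : 0 < εb) (hcrit : Bornology.IsBounded (critSet f εb)) :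
    ∀ M : ℝ, ∃ R : ℝ, 0 < R ∧ ∀ x : Ep p, R ≤ ‖x‖ → M ≤ f x := by
  intro M
  obtain ⟨C, hC₀, hC⟩ := hcrit.exists_pos_norm_le
  obtain ⟨m, hm⟩ := id hbd
  refine ⟨C + |M - m| / εb, by positivity, fun x hx => ?_⟩
  by_contra! hlt
  obtain ⟨y, hyx, hy⟩ := exists_forall_sub_mul_norm_le hf.continuous hbd hεb x
  have hyC : ‖y‖ ≤ C := by
    refine hC y ?_
    have hd := norm_fderiv_le_of_forall_sub_le hεb.le (hf.differentiable one_ne_zero y) hy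
    simpa [critSet, gradient] using hd
  have hmy : m ≤ f y := hm ⟨y, rfl⟩
  have hdist : ‖y - x‖ < |M - m| / εb := by
    rw [lt_div_iff₀ hεb]
    linarith [le_abs_self (M - m)]
  linarith [norm_le_norm_add_norm_sub y x]
end

section
/- Let Z : ℝ^p → Set(ℝ^p) satisfy Assumption (SV), let M > 0 and s̄ > 0. For each s ∈ (0, s̄] let (x_k(s))_{k∈ℕ} be a sequence in ℝ^p with x_{k+1}(s) − x_k(s) ∈ s · Z(x_k(s)) for all k ∈ ℕ, let L(s) be the set of accumulation points of (x_k(s))_{k∈ℕ}, and assume L(s) is nonempty and contained in the closed ball of radius M for all s ∈ (0, s̄]. Define L = ⋂_{α>0} closure(⋃_{0<s≤min(α,s̄)} L(s)). Then L is nonempty, and for every x̄ ∈ L there exists a locally Lipschitz curve x : ℝ → ℝ^p with x(0) = x̄, x(t) ∈ L for all t ∈ ℝ, and x'(t) ∈ Z(x(t)) for almost every t ∈ ℝ. -/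
open Filter MeasureTheory Metric Set Topology
open scoped ENNReal NNReal Pointwise

/-- The graph of a set-valued map. -/
def svGraph {p : ℕ} (Z : Ep p → Set (Ep p)) : Set (Ep p × Ep p) := {q | q.2 ∈ Z q.1}

/-- The set of accumulation points of a sequence. -/
def accPts {p : ℕ} (u : ℕ → Ep p) : Set (Ep p) := {z | MapClusterPt z Filter.atTop u}

section SetValued

variable {E F : Type*} [NormedAddCommGroup E] [NormedAddCommGroup F]

/-- A locally bounded set-valued map is bounded on compact sets. -/
theorem exists_norm_le_of_locallyBounded {Z : E → Set F}
    (hlocbd : ∀ x, ∃ U ∈ 𝓝 x, Bornology.IsBounded (⋃ y ∈ U, Z y))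
    {S : Set E} (hS : IsCompact S) :
    ∃ C : ℝ, 0 < C ∧ ∀ y ∈ S, ∀ w ∈ Z y, ‖w‖ ≤ C := by
  refine hS.induction_on (p := fun S ↦ ∃ C : ℝ, 0 < C ∧ ∀ y ∈ S, ∀ w ∈ Z y, ‖w‖ ≤ C)
    ⟨1, one_pos, by simp⟩ ?_ ?_ ?_
  · rintro s t hst ⟨C, hC, h⟩
    exact ⟨C, hC, fun y hy ↦ h y (hst hy)⟩
  · rintro s t ⟨C, hC, h⟩ ⟨D, hD, h'⟩
    refine ⟨max C D, lt_max_of_lt_left hC, ?_⟩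
    rintro y (hy | hy) w hw
    · exact (h y hy w hw).trans (le_max_left _ _)
    · exact (h' y hy w hw).trans (le_max_right _ _)
  · intro x _
    obtain ⟨U, hU, hb⟩ := hlocbd x
    obtain ⟨C, hC, hb⟩ := hb.exists_pos_norm_le
    exact ⟨U, mem_nhdsWithin_of_mem_nhds hU, C, hC,
      fun y hy w hw ↦ hb w (mem_biUnion hy hw)⟩

/-- A locally bounded set-valued map with closed graph is upper semicontinuous. -/
theorem eventually_subset_thickening [ProperSpace F] {Z : E → Set F}
    (hlocbd : ∀ x, ∃ U ∈ 𝓝 x, Bornology.IsBounded (⋃ y ∈ U, Z y))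
    (hclosed : IsClosed {q : E × F | q.2 ∈ Z q.1}) (x : E) {ε : ℝ} (hε : 0 < ε) :
    ∀ᶠ y in 𝓝 x, Z y ⊆ thickening ε (Z x) := by
  obtain ⟨U, hU, hb⟩ := hlocbd x
  obtain ⟨R, hR⟩ := hb.subset_closedBall 0
  have hK : IsCompact (closedBall (0 : F) R \ thickening ε (Z x)) :=
    (isCompact_closedBall _ _).diff isOpen_thickening
  have hsub : ({x} : Set E) ×ˢ (closedBall (0 : F) R \ thickening ε (Z x)) ⊆
      {q : E × F | q.2 ∈ Z q.1}ᶜ := by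
    rintro ⟨a, b⟩ ⟨rfl, hb⟩ hq
    exact hb.2 (self_subset_thickening hε _ hq)
  obtain ⟨V, W, hV, -, hxV, hKW, hVW⟩ :=
    generalized_tube_lemma isCompact_singleton hK hclosed.isOpen_compl hsub
  filter_upwards [hU, hV.mem_nhds (hxV rfl)] with y hyU hyV w hw
  by_contra hcon
  exact hVW (show (y, w) ∈ V ×ˢ W from ⟨hyV, hKW ⟨hR (mem_biUnion hyU hw), hcon⟩⟩) hw

end SetValued

/-- A relation that is total in both directions has a bi-infinite orbit through every point. -/
theorem exists_int_orbit {α : Type*} {r : α → α → Prop} (hsucc : ∀ a, ∃ b, r a b)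
    (hpred : ∀ a, ∃ b, r b a) (a : α) :
    ∃ f : ℤ → α, f 0 = a ∧ ∀ i, r (f i) (f (i + 1)) := by
  choose S hS using hsucc
  choose P hP using hpred
  refine ⟨fun i ↦ if 0 ≤ i then S^[i.toNat] a else P^[(-i).toNat] a, by simp, fun i ↦ ?_⟩
  rcases lt_trichotomy i (-1) with hi | rfl | hi
  · have h : (-i).toNat = (-(i + 1)).toNat + 1 := by omega
    simp only [show ¬ 0 ≤ i by omega, show ¬ 0 ≤ i + 1 by omega, if_false, h,
      Function.iterate_succ_apply']
    exact hP _
  · simpa using hP a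
  · have h : (i + 1).toNat = i.toNat + 1 := by omega
    simp only [show 0 ≤ i by omega, show 0 ≤ i + 1 by omega, if_true, h,
      Function.iterate_succ_apply']
    exact hS _

section Recursion

variable {E : Type*} [NormedAddCommGroup E] [ProperSpace E]

/-- If the accumulation points of a sequence lie in a closed ball and the steps are small, then
the sequence eventually stays in a slightly larger ball. -/
theorem eventually_mem_closedBall_of_small_steps {u : ℕ → E} {M : ℝ}
    (hne : ∃ z, MapClusterPt z atTop u) (hM : ∀ z, MapClusterPt z atTop u → ‖z‖ ≤ M)
    (hstep : ∀ k, ‖u k‖ ≤ M + 1 → ‖u (k + 1) - u k‖ ≤ 1 / 2) :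
    ∀ᶠ k in atTop, u k ∈ closedBall (0 : E) (M + 1) := by
  have hA : IsCompact (closedBall (0 : E) (M + 1) \ ball 0 (M + 1 / 2)) :=
    (isCompact_closedBall _ _).diff isOpen_ball
  have hev : ∀ᶠ k in atTop, u k ∉ closedBall (0 : E) (M + 1) \ ball 0 (M + 1 / 2) := by
    by_contra hcon
    obtain ⟨z, hz, hz'⟩ := hA.exists_mapClusterPt_of_frequently hcon
    have h1 := hM z hz'
    have h2 := hz.2
    rw [mem_ball_zero_iff] at h2
    linarith
  obtain ⟨N, hN⟩ := eventually_atTop.mp hev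
  obtain ⟨z, hz⟩ := hne
  have hfr : ∃ᶠ k in atTop, u k ∈ ball (0 : E) (M + 1 / 2) :=
    hz.frequently (isOpen_ball.mem_nhds (by
      rw [mem_ball_zero_iff]
      linarith [hM z hz]))
  obtain ⟨k₀, hk₀, hk₀'⟩ := frequently_atTop.mp hfr N
  have key : ∀ k, k₀ ≤ k → ‖u k‖ < M + 1 / 2 := by
    intro k hk
    induction k, hk using Nat.le_induction with
    | base => simpa using hk₀'
    | succ k hk ih =>
      have h1 := hstep k (by linarith)
      have h2 := hN (k + 1) (by omega)
      have h3 := norm_le_norm_add_norm_sub (u k) (u (k + 1))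
      rw [norm_sub_rev] at h3
      rw [Set.mem_sdiff, mem_closedBall_zero_iff, mem_ball_zero_iff] at h2
      by_contra h4
      exact h2 ⟨by linarith, h4⟩
  filter_upwards [eventually_ge_atTop k₀] with k hk
  rw [mem_closedBall_zero_iff]
  linarith [key k hk]

/-- Along an ultrafilter, an eventually bounded sequence in a proper space converges. -/
theorem exists_tendsto_of_eventually_mem_closedBall {ι : Type*} (U : Ultrafilter ι) {v : ι → E}
    {c : E} {R : ℝ} (h : ∀ᶠ k in (U : Filter ι), v k ∈ closedBall c R) :
    ∃ w ∈ closedBall c R, Tendsto v U (𝓝 w) := by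
  obtain ⟨w, hw, hlim⟩ := (isCompact_closedBall c R).ultrafilter_le_nhds (U.map v)
    (le_principal_iff.mpr h)
  exact ⟨w, hw, hlim⟩

/-- Every accumulation point of a bounded solution of a closed recursion has a successor and a
predecessor among the accumulation points. -/
theorem accumulation_succ_pred {u : ℕ → E} {R : ℝ} {G : Set (E × E)} (hG : IsClosed G)
    (hrec : ∀ k, (u k, u (k + 1)) ∈ G) (hbd : ∀ᶠ k in atTop, u k ∈ closedBall (0 : E) R)
    {y : E} (hy : MapClusterPt y atTop u) :
    (∃ w, MapClusterPt w atTop u ∧ (y, w) ∈ G) ∧ ∃ w, MapClusterPt w atTop u ∧ (w, y) ∈ G := by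
  obtain ⟨U, hU, hlim⟩ := mapClusterPt_iff_ultrafilter.mp hy
  have aux : ∀ g : ℕ → ℕ, Tendsto g atTop atTop →
      ∃ w, MapClusterPt w atTop u ∧ Tendsto (u ∘ g) U (𝓝 w) := by
    intro g hg
    obtain ⟨w, -, hw⟩ := exists_tendsto_of_eventually_mem_closedBall U (v := u ∘ g)
      ((hg.mono_left hU).eventually hbd)
    exact ⟨w, mapClusterPt_iff_ultrafilter.mpr ⟨U.map g, hg.mono_left hU, hw⟩, hw⟩
  constructor
  · obtain ⟨w, hw, hlim'⟩ := aux (· + 1) (tendsto_add_atTop_nat 1)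
    exact ⟨w, hw, hG.mem_of_tendsto (hlim.prodMk_nhds hlim') (Eventually.of_forall hrec)⟩
  · obtain ⟨w, hw, hlim'⟩ := aux (· - 1) (tendsto_sub_atTop_nat 1)
    refine ⟨w, hw, hG.mem_of_tendsto (hlim'.prodMk_nhds hlim) ?_⟩
    filter_upwards [hU (eventually_ge_atTop 1)] with k hk
    simpa [Nat.sub_add_cancel hk] using hrec (k - 1)

end Recursion

/-- Increments of a sequence with bounded steps grow at most linearly. -/
theorem norm_add_natCast_sub_le {E : Type*} [NormedAddCommGroup E] {y : ℤ → E} {c : ℝ}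
    (h : ∀ i, ‖y (i + 1) - y i‖ ≤ c) (i : ℤ) (N : ℕ) : ‖y (i + N) - y i‖ ≤ N * c := by
  induction N with
  | zero => simp
  | succ N ih =>
    have h1 := norm_sub_le_norm_sub_add_norm_sub (y (i + N + 1)) (y (i + N)) (y i)
    have h2 := h (i + N)
    push_cast
    rw [← add_assoc]
    linarith

section Curve

variable {E : Type*} [NormedAddCommGroup E] [NormedSpace ℝ E]

/-- Increments of an Euler orbit whose velocities lie in a convex set are multiples of elements
of this set. -/
theorem add_natCast_sub_mem_smul {y : ℤ → E} {s : ℝ} (hs : 0 ≤ s) {K : Set E}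
    (hK : Convex ℝ K) (hne : K.Nonempty) (i : ℤ) (N : ℕ)
    (h : ∀ j < N, y (i + j + 1) - y (i + j) ∈ s • K) : y (i + N) - y i ∈ (N * s) • K := by
  induction N with
  | zero => simp [zero_smul_set hne]
  | succ N ih =>
    have h1 := ih fun j hj ↦ h j (by omega)
    have h2 := h N (by omega)
    have h3 : ((N + 1 : ℕ) : ℝ) * s = N * s + s := by push_cast; ring
    rw [h3, hK.add_smul (by positivity) hs]
    refine ⟨_, h1, _, h2, ?_⟩
    push_cast
    rw [← add_assoc]
    abel

theorem tendsto_mul_floor_div {ι : Type*} {l : Filter ι} {s : ι → ℝ} (hs : ∀ n, 0 < s n)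
    (hlim : Tendsto s l (𝓝 0)) (t : ℝ) :
    Tendsto (fun n ↦ (⌊t / s n⌋ : ℝ) * s n) l (𝓝 t) := by
  refine tendsto_of_tendsto_of_tendsto_of_le_of_le (g := fun n ↦ t - s n) (h := fun _ ↦ t)
    (by simpa using tendsto_const_nhds.sub hlim) tendsto_const_nhds (fun n ↦ ?_) fun n ↦ ?_
  · have h := (Int.sub_one_lt_floor (t / s n)).le
    have := mul_le_mul_of_nonneg_right h (hs n).le
    rwa [sub_mul, div_mul_cancel₀ _ (hs n).ne', one_mul] at this
  · have := mul_le_mul_of_nonneg_right (Int.floor_le (t / s n)) (hs n).le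
    rwa [div_mul_cancel₀ _ (hs n).ne'] at this

/-- Bounded bi-infinite Euler orbits with step sizes tending to zero converge, along an
ultrafilter, to a solution of the differential inclusion. -/
theorem exists_curve_of_euler_orbits [FiniteDimensional ℝ E] {Z : E → Set E}
    (hne : ∀ x, (Z x).Nonempty) (hconv : ∀ x, Convex ℝ (Z x)) (hZc : ∀ x, IsClosed (Z x))
    (husc : ∀ x, ∀ ε : ℝ, 0 < ε → ∀ᶠ y in 𝓝 x, Z y ⊆ thickening ε (Z x))
    {C R : ℝ} (hC : 0 ≤ C) {s : ℕ → ℝ} (hs : ∀ n, 0 < s n) (hs0 : Tendsto s atTop (𝓝 0))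
    {y : ℕ → ℤ → E} (hbd : ∀ n i, y n i ∈ closedBall 0 R)
    (hstep : ∀ n i, ‖y n (i + 1) - y n i‖ ≤ C * s n)
    (hrec : ∀ n i, y n (i + 1) - y n i ∈ s n • Z (y n i))
    {z : E} (hz : Tendsto (fun n ↦ y n 0) atTop (𝓝 z)) :
    ∃ γ : ℝ → E, γ 0 = z ∧ LipschitzWith C.toNNReal γ ∧
      (∀ S, IsClosed S → (∀ᶠ n in atTop, ∀ i, y n i ∈ S) → ∀ t, γ t ∈ S) ∧
      ∀ᵐ t : ℝ, deriv γ t ∈ Z (γ t) := by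
  have : ProperSpace E := FiniteDimensional.proper_real E
  let U : Ultrafilter ℕ := hyperfilter ℕ
  have hU : (U : Filter ℕ) ≤ atTop := by
    rw [← Nat.cofinite_eq_atTop]
    exact hyperfilter_le_cofinite
  have hlim : ∀ t : ℝ, ∃ w, Tendsto (fun n ↦ y n ⌊t / s n⌋) U (𝓝 w) := fun t ↦ by
    obtain ⟨w, -, hw⟩ := exists_tendsto_of_eventually_mem_closedBall U
      (v := fun n ↦ y n ⌊t / s n⌋) (Eventually.of_forall fun n ↦ hbd n _)
    exact ⟨w, hw⟩
  choose γ hγ using hlim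
  have hs0' : Tendsto s U (𝓝 0) := hs0.mono_left hU
  have hfloor := fun t ↦ tendsto_mul_floor_div hs hs0' t
  have hfloorsub : ∀ t t' : ℝ,
      Tendsto (fun n ↦ ((⌊t' / s n⌋ - ⌊t / s n⌋ : ℤ) : ℝ) * s n) U (𝓝 (t' - t)) := fun t t' ↦ by
    simpa [sub_mul] using (hfloor t').sub (hfloor t)
  have hle : ∀ t t' : ℝ, t ≤ t' → ‖γ t' - γ t‖ ≤ C * (t' - t) := by
    intro t t' htt
    refine le_of_tendsto_of_tendsto ((hγ t').sub (hγ t)).norm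
      ((hfloorsub t t').const_mul C) (Eventually.of_forall fun n ↦ ?_)
    obtain ⟨N, hN⟩ := Int.le.dest
      (Int.floor_le_floor (div_le_div_of_nonneg_right htt (hs n).le))
    have h := norm_add_natCast_sub_le (hstep n) ⌊t / s n⌋ N
    have hN' : ((⌊t' / s n⌋ - ⌊t / s n⌋ : ℤ) : ℝ) = N := by
      rw [← hN]
      push_cast
      ring
    rw [hN] at h
    simp only [hN']
    linarith
  have hlip : LipschitzWith C.toNNReal γ := by
    refine LipschitzWith.of_dist_le_mul fun t t' ↦ ?_
    rw [Real.coe_toNNReal C hC, dist_eq_norm, Real.dist_eq]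
    rcases le_total t t' with h | h
    · rw [norm_sub_rev, abs_sub_comm, abs_of_nonneg (sub_nonneg.mpr h)]
      exact hle t t' h
    · rw [abs_of_nonneg (sub_nonneg.mpr h)]
      exact hle t' t h
  have hquot : ∀ t ε : ℝ, 0 < ε → ∀ᶠ h in 𝓝[>] (0 : ℝ),
      h⁻¹ • (γ (t + h) - γ t) ∈ cthickening ε (Z (γ t)) := by
    intro t ε hε
    obtain ⟨δ, hδ, hsub⟩ := Metric.eventually_nhds_iff.mp (husc (γ t) ε hε)
    have hpos : 0 < δ / (2 * (C + 1)) := by positivity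
    filter_upwards [Ioo_mem_nhdsGT hpos] with h ⟨h0, hh⟩
    have hCh : C * h < δ / 2 := by
      rw [lt_div_iff₀ (by positivity)] at hh
      nlinarith
    have hm : Tendsto (fun n ↦ ((⌊(t + h) / s n⌋ - ⌊t / s n⌋ : ℤ) : ℝ) * s n) U (𝓝 h) := by
      simpa using hfloorsub t (t + h)
    refine isClosed_cthickening.mem_of_tendsto
      ((hm.inv₀ h0.ne').smul ((hγ (t + h)).sub (hγ t))) ?_
    have hd : ∀ᶠ n in (U : Filter ℕ), dist (y n ⌊t / s n⌋) (γ t) < δ / 2 :=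
      (hγ t).eventually (ball_mem_nhds _ (half_pos hδ))
    filter_upwards [hd, hm.eventually (lt_mem_nhds h0),
      (hm.const_mul C).eventually (gt_mem_nhds hCh)] with n hdn hpn hCn
    obtain ⟨N, hN⟩ := Int.le.dest (Int.floor_le_floor
      (div_le_div_of_nonneg_right (le_add_of_nonneg_right h0.le : t ≤ t + h) (hs n).le))
    have hN' : ((⌊(t + h) / s n⌋ - ⌊t / s n⌋ : ℤ) : ℝ) = N := by
      rw [← hN]
      push_cast
      ring
    rw [hN'] at hpn hCn ⊢
    have hmem := add_natCast_sub_mem_smul (hs n).le ((hconv (γ t)).thickening ε)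
      ((hne (γ t)).mono (self_subset_thickening hε _)) (y := y n) ⌊t / s n⌋ N fun j hj ↦ by
        refine smul_set_mono (hsub ?_) (hrec n _)
        have h1 := norm_add_natCast_sub_le (hstep n) ⌊t / s n⌋ j
        have h2 : (j : ℝ) * (C * s n) ≤ N * (C * s n) :=
          mul_le_mul_of_nonneg_right (by exact_mod_cast hj.le) (mul_nonneg hC (hs n).le)
        have h3 := dist_triangle (y n (⌊t / s n⌋ + j)) (y n ⌊t / s n⌋) (γ t)
        rw [dist_eq_norm (y n (⌊t / s n⌋ + j)) (y n ⌊t / s n⌋)] at h3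
        linarith
    rw [hN] at hmem
    exact thickening_subset_cthickening _ _ ((mem_smul_set_iff_inv_smul_mem₀ hpn.ne' _ _).mp hmem)
  refine ⟨γ, tendsto_nhds_unique (hγ 0) (by simpa using hz.mono_left hU), hlip,
    fun S hS hev t ↦ hS.mem_of_tendsto (hγ t) ?_, ?_⟩
  · filter_upwards [hU hev] with n hn using hn _
  · filter_upwards [hlip.ae_differentiableAt] with t ht
    rw [← (hZc (γ t)).closure_eq, closure_eq_iInter_cthickening]
    refine mem_iInter₂.mpr fun ε hε ↦ isClosed_cthickening.mem_of_tendsto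
      (ht.hasDerivAt.tendsto_slope_zero_right) (hquot t ε hε)

end Curve

theorem stmt12 {p : ℕ} (Z : Ep p → Set (Ep p))
    (hne : ∀ x, (Z x).Nonempty) (hconv : ∀ x, Convex ℝ (Z x))
    (hlocbd : ∀ x : Ep p, ∃ U ∈ nhds x, Bornology.IsBounded (⋃ y ∈ U, Z y))
    (hclosed : IsClosed (svGraph Z))
    (M sb : ℝ) (hM : 0 < M) (hsb : 0 < sb)
    (x : ℝ → ℕ → Ep p)
    (hrec : ∀ s : ℝ, 0 < s → s ≤ sb → ∀ k : ℕ, x s (k + 1) - x s k ∈ s • Z (x s k))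
    (hacc : ∀ s : ℝ, 0 < s → s ≤ sb →
      (accPts (x s)).Nonempty ∧ accPts (x s) ⊆ Metric.closedBall 0 M)
    (L : Set (Ep p))
    (hL : L = ⋂ (α : ℝ) (_ : 0 < α),
      closure (⋃ (s : ℝ) (_ : 0 < s ∧ s ≤ min α sb), accPts (x s))) :
    L.Nonempty ∧ ∀ z ∈ L, ∃ γ : ℝ → Ep p,
      γ 0 = z ∧ (∀ t : ℝ, γ t ∈ L) ∧
      (∀ t : ℝ, ∃ K : NNReal, ∃ U ∈ nhds t, LipschitzOnWith K γ U) ∧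
      ∀ᵐ t : ℝ, deriv γ t ∈ Z (γ t) := by
  have hZc : ∀ a, IsClosed (Z a) := fun a ↦ hclosed.preimage (Continuous.prodMk_right a)
  obtain ⟨C, hC, hCb⟩ := exists_norm_le_of_locallyBounded hlocbd
    (isCompact_closedBall (0 : Ep p) (M + 1))
  have hincr : ∀ s, 0 < s → ∀ a ∈ closedBall (0 : Ep p) (M + 1), ∀ b, b - a ∈ s • Z a →
      ‖b - a‖ ≤ C * s := by
    rintro s hs a ha b ⟨w, hw, hb⟩
    rw [← hb, norm_smul, Real.norm_of_nonneg hs.le, mul_comm]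
    exact mul_le_mul_of_nonneg_right (hCb a ha w hw) hs.le
  have horbit : ∀ s, 0 < s → s ≤ sb → C * s ≤ 1 / 2 → ∀ w ∈ accPts (x s),
      ∃ f : ℤ → Ep p, f 0 = w ∧ ∀ i, f i ∈ accPts (x s) ∧ f (i + 1) - f i ∈ s • Z (f i) := by
    intro s hs hsb' hCs w hw
    have hbd := eventually_mem_closedBall_of_small_steps (u := x s) (hacc s hs hsb').1
      (fun v hv ↦ by simpa using (hacc s hs hsb').2 hv) fun k hk ↦
        (hincr s hs _ (by simpa using hk) _ (hrec s hs hsb' k)).trans hCs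
    have hG : IsClosed {q : Ep p × Ep p | q.2 - q.1 ∈ s • Z q.1} := by
      have : {q : Ep p × Ep p | q.2 - q.1 ∈ s • Z q.1} =
          (fun q : Ep p × Ep p ↦ (q.1, s⁻¹ • (q.2 - q.1))) ⁻¹' svGraph Z := by
        ext q
        exact mem_smul_set_iff_inv_smul_mem₀ hs.ne' _ _
      rw [this]
      exact hclosed.preimage (by fun_prop)
    have hsp := fun v (hv : v ∈ accPts (x s)) ↦
      accumulation_succ_pred hG (hrec s hs hsb') hbd hv
    obtain ⟨f, hf0, hf⟩ := exists_int_orbit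
      (r := fun a b : accPts (x s) ↦ (b : Ep p) - a ∈ s • Z a)
      (fun a ↦ let ⟨b, hb, h⟩ := (hsp a a.2).1; ⟨⟨b, hb⟩, h⟩)
      (fun a ↦ let ⟨b, hb, h⟩ := (hsp a a.2).2; ⟨⟨b, hb⟩, h⟩) ⟨w, hw⟩
    exact ⟨fun i ↦ f i, by simp [hf0], fun i ↦ ⟨(f i).2, hf i⟩⟩
  have hinv : Tendsto (fun n : ℕ ↦ 1 / ((n : ℝ) + 1)) atTop (𝓝 0) :=
    tendsto_one_div_add_atTop_nhds_zero_nat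
  have hclos : ∀ s : ℕ → ℝ, (∀ n, 0 < s n) → (∀ n, s n ≤ sb) → Tendsto s atTop (𝓝 0) →
      ∀ α : ℝ, 0 < α → ∀ᶠ n in atTop, accPts (x (s n)) ⊆
        closure (⋃ (s : ℝ) (_ : 0 < s ∧ s ≤ min α sb), accPts (x s)) := by
    intro s hs hsb' hs0 α hα
    filter_upwards [hs0.eventually (gt_mem_nhds hα)] with n hn
    exact (subset_biUnion_of_mem (u := fun s ↦ accPts (x s))
      (show 0 < s n ∧ s n ≤ min α sb from ⟨hs n, le_min hn.le (hsb' n)⟩)).trans subset_closure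
  subst hL
  constructor
  · have hspos : ∀ n : ℕ, 0 < sb * (1 / ((n : ℝ) + 1)) := fun n ↦ by positivity
    have hsle : ∀ n : ℕ, sb * (1 / ((n : ℝ) + 1)) ≤ sb := fun n ↦
      mul_le_of_le_one_right hsb.le (by
        rw [div_le_one (by positivity)]
        linarith [(Nat.cast_nonneg n : (0 : ℝ) ≤ n)])
    choose y hy using fun n : ℕ ↦ (hacc _ (hspos n) (hsle n)).1
    obtain ⟨w, -, hw⟩ := exists_tendsto_of_eventually_mem_closedBall (hyperfilter ℕ)
      (v := y) (Eventually.of_forall fun n ↦ (hacc _ (hspos n) (hsle n)).2 (hy n))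
    have hU : (hyperfilter ℕ : Filter ℕ) ≤ atTop := by
      rw [← Nat.cofinite_eq_atTop]
      exact hyperfilter_le_cofinite
    refine ⟨w, mem_iInter₂.mpr fun α hα ↦ isClosed_closure.mem_of_tendsto hw ?_⟩
    filter_upwards [hU (hclos _ hspos hsle (by simpa using hinv.const_mul sb) α hα)] with n hn
    exact hn (hy n)
  · intro z hz
    have hs₀ : 0 < 1 / (2 * C) := by positivity
    have hchoose : ∀ n : ℕ, ∃ s, (0 < s ∧ s ≤ sb ∧ C * s ≤ 1 / 2 ∧ s ≤ 1 / ((n : ℝ) + 1)) ∧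
        ∃ w ∈ accPts (x s), dist w z ≤ 1 / ((n : ℝ) + 1) := by
      intro n
      have hn : 0 < 1 / ((n : ℝ) + 1) := by positivity
      obtain ⟨w, hw, hd⟩ := Metric.mem_closure_iff.mp
        (mem_iInter₂.mp hz _ (lt_min hs₀ hn)) _ hn
      obtain ⟨s, ⟨h0, hs⟩, hw⟩ := mem_iUnion₂.mp hw
      obtain ⟨⟨h1, h2⟩, h3⟩ := by simpa only [le_min_iff] using hs
      refine ⟨s, ⟨h0, h3, ?_, h2⟩, w, hw, by rw [dist_comm]; exact hd.le⟩
      rw [le_div_iff₀ (by positivity)] at h1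
      linarith
    choose s hs w hw hwz using hchoose
    choose y hy0 hy using fun n ↦ horbit (s n) (hs n).1 (hs n).2.1 (hs n).2.2.1 (w n) (hw n)
    have hs0 : Tendsto s atTop (𝓝 0) :=
      squeeze_zero (fun n ↦ (hs n).1.le) (fun n ↦ (hs n).2.2.2) hinv
    have hbd : ∀ n i, y n i ∈ closedBall (0 : Ep p) M := fun n i ↦
      (hacc _ (hs n).1 (hs n).2.1).2 (hy n i).1
    obtain ⟨γ, hγ0, hlip, hmem, hderiv⟩ := exists_curve_of_euler_orbits hne hconv hZc
      (fun a ε hε ↦ eventually_subset_thickening hlocbd hclosed a hε) hC.le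
      (fun n ↦ (hs n).1) hs0 hbd
      (fun n i ↦ hincr _ (hs n).1 _
        (closedBall_subset_closedBall (by linarith) (hbd n i)) _ (hy n i).2)
      (fun n i ↦ (hy n i).2)
      (by
        simp only [hy0]
        exact tendsto_iff_dist_tendsto_zero.mpr
          (squeeze_zero (fun _ ↦ dist_nonneg) hwz hinv))
    refine ⟨γ, hγ0, fun t ↦ mem_iInter₂.mpr fun α hα ↦ hmem _ isClosed_closure ?_ t,
      fun t ↦ ⟨_, univ, univ_mem, hlip.lipschitzOnWith⟩, hderiv⟩
    filter_upwards [hclos s (fun n ↦ (hs n).1) (fun n ↦ (hs n).2.1) hs0 α hα] with n hn i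
    exact hn (hy n i).1
end

section
/- Let t ∈ (0,1) and s > 0, and define g : [0,∞) → ℝ by g(δ) = s·δ^t − δ. Then for all δ ≥ 0, g(δ) ≤ −(1 − t)(δ − s^{1/(1−t)}). -/
theorem stmt19 (t s : ℝ) (ht0 : 0 < t) (ht1 : t < 1) (hs : 0 < s) :
    ∀ δ : ℝ, 0 ≤ δ → s * δ ^ t - δ ≤ -((1 - t) * (δ - s ^ (1 / (1 - t)))) := by
  intro δ hδ
  have amgm := Real.geom_mean_le_arith_mean2_weighted (sub_nonneg.2 ht1.le) ht0.le
    (Real.rpow_nonneg hs.le (1 / (1 - t))) hδ (sub_add_cancel 1 t)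
  rw [← Real.rpow_mul hs.le, one_div_mul_cancel (sub_pos.2 ht1).ne', Real.rpow_one] at amgm
  linarith
end
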